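/- Let G be obtained from the prism C_n □ K_2 by applying TF-inflations at vertices lying on at least r ≥ 3 distinct pillars. Then G is hamiltonian if and only if n is even. -/

import Mathlib

open SimpleGraph

/-- Vertex type of the `n`-prism `C_n □ K_2`: the base cycle consists of the
vertices `(i, false)` (the `sᵢ`) and the top cycle of the vertices `(i, true)` (the `tᵢ`). -/
abbrev PV (n : ℕ) := ZMod n × Bool

/-- The prism graph `C_n □ K_2`. -/
def prismG (n : ℕ) : SimpleGraph (PV n) :=
  SimpleGraph.fromRel fun u v =>
    (u.1 = v.1 ∧ u.2 ≠ v.2) ∨ (u.2 = v.2 ∧ v.1 = u.1 + 1)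

/-- The pillar edge `sᵢtᵢ`. -/
def pillar (n : ℕ) (i : ZMod n) : Sym2 (PV n) :=
  s(((i, false) : PV n), ((i, true) : PV n))

/-- The base-cycle edge `sᵢs_{i+1}`. -/
def baseEdge (n : ℕ) (i : ZMod n) : Sym2 (PV n) :=
  s(((i, false) : PV n), ((i + 1, false) : PV n))

/-- The top-cycle edge `tᵢt_{i+1}`. -/
def topEdge (n : ℕ) (i : ZMod n) : Sym2 (PV n) :=
  s(((i, true) : PV n), ((i + 1, true) : PV n))

def IsPillar {n : ℕ} (e : Sym2 (PV n)) : Prop := ∃ i, e = pillar n i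
def IsBaseEdge {n : ℕ} (e : Sym2 (PV n)) : Prop := ∃ i, e = baseEdge n i
def IsTopEdge {n : ℕ} (e : Sym2 (PV n)) : Prop := ∃ i, e = topEdge n i

/-- A hamiltonian cycle of the prism is *meandering* if no two of its edges lying on the
top cycle or on the base cycle are adjacent (share a vertex; in a cycle, edges sharing a
vertex are exactly the consecutive ones). -/
def Meandering {n : ℕ} {v : PV n} (C : (prismG n).Walk v v) : Prop :=
  ∀ e ∈ C.edges, ∀ f ∈ C.edges, e ≠ f →
    ((IsBaseEdge e ∧ IsBaseEdge f) ∨ (IsTopEdge e ∧ IsTopEdge f)) → ¬ ∃ x, x ∈ e ∧ x ∈ f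

/-- Explicit edge list of the Tutte Fragment on 15 vertices, following Tutte (1946):
`0 = a`, `1 = b` (the two bottom corner 2-valent vertices), `2 = c` (the apex 2-valent
vertex); `3, …, 14` are the internal 3-valent vertices `p₁, …, p₁₂`. -/
def TFedges : List (Fin 15 × Fin 15) :=
  [(0,4),(4,5),(5,6),(6,2),(1,7),(7,8),(8,2),(0,14),(14,1),(4,9),(9,3),(3,10),(10,7),
   (5,11),(11,12),(6,13),(13,8),(13,12),(12,10),(11,9),(3,14)]

/-- The Tutte Fragment as a simple graph on `Fin 15`. -/
def TF : SimpleGraph (Fin 15) :=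
  SimpleGraph.fromRel fun x y => (x, y) ∈ TFedges

/-- The attachment port of the prism vertex `u` used for the former prism edge towards the
neighbour `w`, after the TF-inflations prescribed by the set `S` of inflated vertices and the
orientation choice `orient`.  A non-inflated vertex keeps its single representative (port `0`);
for an inflated vertex the vertex `c = 2` of its Tutte Fragment is incident with the pillar,
and the vertices `a = 0`, `b = 1` are attached to the two cycle neighbours according to
`orient u`. -/
def port {n : ℕ} (S : Finset (PV n)) (orient : PV n → Bool) (u w : PV n) : Fin 15 :=
  if u ∉ S then 0
  else if u.1 = w.1 then 2
  else if w.1 = u.1 + 1 then (if orient u then 0 else 1)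
  else (if orient u then 1 else 0)

/-- Vertex type of the TF-inflated prism: an inflated prism vertex `v ∈ S` is replaced by the
15 vertices `(v, k)` of a fresh copy of the Tutte Fragment, while a non-inflated vertex `v`
is represented by `(v, 0)` alone. -/
def InflV (n : ℕ) (S : Finset (PV n)) := {x : PV n × Fin 15 // x.1 ∈ S ∨ x.2 = 0}

/-- The graph obtained from the prism `C_n □ K_2` by TF-inflating every vertex in `S`
(with orientations `orient`, and with the `c`-vertex of each fragment incident to the
corresponding pillar). -/
def inflPrism (n : ℕ) (S : Finset (PV n)) (orient : PV n → Bool) :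
    SimpleGraph (InflV n S) :=
  SimpleGraph.fromRel fun x y =>
    (x.val.1 = y.val.1 ∧ x.val.1 ∈ S ∧ TF.Adj x.val.2 y.val.2) ∨
    (x.val.1 ≠ y.val.1 ∧ (prismG n).Adj x.val.1 y.val.1 ∧
      x.val.2 = port S orient x.val.1 y.val.1 ∧
      y.val.2 = port S orient y.val.1 x.val.1)

/-- The vertex of the inflated prism representing the attachment port of the prism vertex `u`
towards its prism neighbour `w`. -/
def liftV {n : ℕ} (S : Finset (PV n)) (orient : PV n → Bool) (u w : PV n) :
    InflV n S :=
  ⟨(u, port S orient u w), by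
    by_cases h : u ∈ S
    · exact Or.inl h
    · exact Or.inr (by simp [port, h])⟩

/-- The set of (indices of) pillars of the prism carrying at least one TF-inflated vertex. -/
def inflatedPillars {n : ℕ} (S : Finset (PV n)) : Set (ZMod n) :=
  {i : ZMod n | ((i, false) : PV n) ∈ S ∨ ((i, true) : PV n) ∈ S}

instance (n : ℕ) (S : Finset (PV n)) : DecidableEq (InflV n S) := by
  unfold InflV; infer_instance


section helpers

structure HamU {V : Type*} (G : SimpleGraph V) (U : V → V → Prop) : Prop where
  symm : ∀ x y, U x y → U y x
  adj : ∀ x y, U x y → G.Adj x y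
  deg : ∀ v a b c, a ≠ b → a ≠ c → b ≠ c → (∀ w, G.Adj v w → w = a ∨ w = b ∨ w = c) →
    (U v a ∧ U v b ∧ ¬ U v c) ∨ (U v a ∧ ¬ U v b ∧ U v c) ∨ (¬ U v a ∧ U v b ∧ U v c)
  cut : ∀ A : Set V, ∀ x ∈ A, ∀ y, y ∉ A → ∃ u ∈ A, ∃ w, w ∉ A ∧ U u w

lemma hamU_of_cycle {V : Type*} [DecidableEq V] {G : SimpleGraph V} {x : V} (C : G.Walk x x)
    (hC : C.IsHamiltonianCycle) : HamU G C.toSubgraph.Adj where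
  symm := fun x y h => h.symm
  adj := fun x y h => h.adj_sub
  deg := by
    intro v a b c hab hac hbc h
    have h2 := hC.isCycle.ncard_neighborSet_toSubgraph_eq_two (hC.mem_support v)
    rw [Set.ncard_eq_two] at h2
    obtain ⟨p, q, hpq, hs⟩ := h2
    have key : ∀ w, C.toSubgraph.Adj v w ↔ w = p ∨ w = q := by
      intro w
      have : w ∈ C.toSubgraph.neighborSet v ↔ w ∈ ({p, q} : Set V) := by rw [hs]
      simpa using this
    have hp := h p ((key p).2 (Or.inl rfl)).adj_sub
    have hq := h q ((key q).2 (Or.inr rfl)).adj_sub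
    simp only [key]
    grind
  cut := by
    intro A y hy z hz
    have main : ∀ B : Set V, x ∈ B → ∀ z, z ∉ B → ∃ u ∈ B, ∃ w, w ∉ B ∧ C.toSubgraph.Adj u w := by
      intro B hx z hz
      obtain ⟨d, hd, h1, h2⟩ := (C.takeUntil z (hC.mem_support z)).exists_boundary_dart B hx hz
      refine ⟨d.fst, h1, d.snd, h2, ?_⟩
      rw [← SimpleGraph.Subgraph.mem_edgeSet, SimpleGraph.Walk.mem_edges_toSubgraph]
      have := C.darts_takeUntil_subset_darts (hC.mem_support z) hd
      exact List.mem_map.2 ⟨d, this, rfl⟩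
    by_cases hx : x ∈ A
    · exact main A hx z hz
    · obtain ⟨u, hu, w, hw, h⟩ := main Aᶜ hx y (by simpa using hy)
      exact ⟨w, by simpa using hw, u, hu, h.symm⟩

lemma tf_parity (x : Fin 15 → Fin 15 → ℕ) (hc : ∀ i j, x i j = x j i) (a b c : ℕ)
    (h0 : x 0 4 + x 0 14 + a = 2) (h1 : x 1 7 + x 1 14 + b = 2) (h2 : x 2 6 + x 2 8 + c = 2)
    (h3 : x 3 9 + x 3 10 + x 3 14 = 2) (h4 : x 4 0 + x 4 5 + x 4 9 = 2)
    (h5 : x 5 4 + x 5 6 + x 5 11 = 2) (h6 : x 6 5 + x 6 2 + x 6 13 = 2)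
    (h7 : x 7 1 + x 7 8 + x 7 10 = 2) (h8 : x 8 7 + x 8 2 + x 8 13 = 2)
    (h9 : x 9 4 + x 9 3 + x 9 11 = 2) (h10 : x 10 3 + x 10 7 + x 10 12 = 2)
    (h11 : x 11 5 + x 11 12 + x 11 9 = 2) (h12 : x 12 11 + x 12 13 + x 12 10 = 2)
    (h13 : x 13 6 + x 13 8 + x 13 12 = 2) (h14 : x 14 0 + x 14 1 + x 14 3 = 2) :
    2 ∣ a + b + c := by
  rw [hc 4 0] at h4
  rw [hc 5 4] at h5
  rw [hc 6 5, hc 6 2] at h6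
  rw [hc 7 1] at h7
  rw [hc 8 7, hc 8 2] at h8
  rw [hc 9 4, hc 9 3] at h9
  rw [hc 10 3, hc 10 7] at h10
  rw [hc 11 5, hc 11 9] at h11
  rw [hc 12 11, hc 12 10] at h12
  rw [hc 13 6, hc 13 8, hc 13 12] at h13
  rw [hc 14 0, hc 14 1, hc 14 3] at h14
  omega

set_option maxHeartbeats 4000000 in
lemma tf_noab (x : Fin 15 → Fin 15 → ℕ) (hc : ∀ i j, x i j = x j i) (hle : ∀ i j, x i j ≤ 1)
    (h0 : x 0 4 + x 0 14 + 1 = 2) (h1 : x 1 7 + x 1 14 + 1 = 2) (h2 : x 2 6 + x 2 8 + 0 = 2)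
    (h3 : x 3 9 + x 3 10 + x 3 14 = 2) (h4 : x 4 0 + x 4 5 + x 4 9 = 2)
    (h5 : x 5 4 + x 5 6 + x 5 11 = 2) (h6 : x 6 5 + x 6 2 + x 6 13 = 2)
    (h7 : x 7 1 + x 7 8 + x 7 10 = 2) (h8 : x 8 7 + x 8 2 + x 8 13 = 2)
    (h9 : x 9 4 + x 9 3 + x 9 11 = 2) (h10 : x 10 3 + x 10 7 + x 10 12 = 2)
    (h11 : x 11 5 + x 11 12 + x 11 9 = 2) (h12 : x 12 11 + x 12 13 + x 12 10 = 2)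
    (h13 : x 13 6 + x 13 8 + x 13 12 = 2) (h14 : x 14 0 + x 14 1 + x 14 3 = 2)
    (c1 : 1 ≤ x 4 0 + x 7 1 + x 3 14)
    (c2 : 1 ≤ x 6 5 + x 8 7 + x 13 12)
    (c3 : 1 ≤ x 4 0 + x 5 6 + x 9 3 + x 11 12)
    (c4 : 1 ≤ x 4 0 + x 9 3 + x 8 7 + x 12 10)
    (c5 : 1 ≤ x 6 5 + x 7 1 + x 12 11 + x 10 3) : False := by
  rw [hc 4 0] at h4 c1 c3 c4
  rw [hc 5 4] at h5
  rw [hc 6 5] at h6 c2 c5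
  rw [hc 6 2] at h6
  rw [hc 7 1] at h7 c1 c5
  rw [hc 8 7] at h8 c2 c4
  rw [hc 8 2] at h8
  rw [hc 9 3] at h9 c3 c4
  rw [hc 9 4] at h9
  rw [hc 10 3] at h10 c5
  rw [hc 10 7] at h10
  rw [hc 11 5, hc 11 9] at h11
  rw [hc 12 11] at h12 c5
  rw [hc 12 10] at h12 c4
  rw [hc 13 12] at h13 c2
  rw [hc 13 6, hc 13 8] at h13
  rw [hc 14 0, hc 14 1, hc 14 3] at h14
  have := hle 0 4
  have := hle 0 14
  have := hle 1 7
  have := hle 1 14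
  have := hle 2 6
  have := hle 2 8
  have := hle 3 9
  have := hle 3 10
  have := hle 3 14
  have := hle 4 5
  have := hle 4 9
  have := hle 5 6
  have := hle 5 11
  have := hle 6 13
  have := hle 7 8
  have := hle 7 10
  have := hle 8 13
  have := hle 9 11
  have := hle 10 12
  have := hle 11 12
  have := hle 12 13
  have e1 : x 2 6 = 1 := by omega
  have e2 : x 2 8 = 1 := by omega
  rw [e1] at h6
  rw [e2] at h8
  clear h2
  have A : ∀ m : ℕ, m ≤ 1 → m = 0 ∨ m = 1 := by omega
  rcases A _ (hle 0 4) with h | h <;> rcases A _ (hle 1 7) with h' | h' <;>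
  rcases A _ (hle 5 6) with h'' | h'' <;> rcases A _ (hle 7 8) with h''' | h''' <;>
  simp only [h, h', h'', h'''] at * <;>
  omega

instance : DecidableRel TF.Adj := by
  unfold TF; intro x y; rw [SimpleGraph.fromRel_adj]; infer_instance

lemma zmod_ne1 {n : ℕ} (hn : 3 ≤ n) (i : ZMod n) : i + 1 ≠ i := by
  have : Fact (1 < n) := ⟨by omega⟩
  simp

lemma zmod_two {n : ℕ} (hn : 3 ≤ n) : (2 : ZMod n) ≠ 0 := by
  intro h
  have h2 : ((2 : ℕ) : ZMod n) = 0 := by exact_mod_cast h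
  rw [ZMod.natCast_eq_zero_iff] at h2
  have := Nat.le_of_dvd (by norm_num) h2
  omega

lemma zmod_ne2 {n : ℕ} (hn : 3 ≤ n) (i : ZMod n) : i - 1 ≠ i + 1 := by
  intro h
  apply zmod_two hn
  linear_combination -h

lemma zmod_ne3 {n : ℕ} (hn : 3 ≤ n) (i : ZMod n) : i - 1 ≠ i := by
  intro h
  apply zmod_ne1 hn i
  linear_combination -h

lemma prism_adj {n : ℕ} (hn : 3 ≤ n) (i : ZMod n) (s : Bool) (w : PV n) :
    (prismG n).Adj (i, s) w ↔ w = (i + 1, s) ∨ w = (i - 1, s) ∨ w = (i, !s) := by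
  obtain ⟨j, t⟩ := w
  have h1 := zmod_ne1 hn i
  have h3 := zmod_ne3 hn i
  simp only [prismG, SimpleGraph.fromRel_adj, Prod.mk.injEq, ne_eq]
  constructor
  · rintro ⟨hne, (⟨rfl, h⟩ | ⟨rfl, rfl⟩) | (⟨rfl, h⟩ | ⟨rfl, rfl⟩)⟩
    · right; right; simp; revert h; cases s <;> cases t <;> simp
    · simp
    · right; right; simp; revert h; cases s <;> cases t <;> simp
    · simp
  · rintro (⟨rfl, rfl⟩ | ⟨rfl, rfl⟩ | ⟨rfl, rfl⟩)
    · exact ⟨fun h => h1 h.1.symm, by simp⟩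
    · simp [Ne.symm h3]
    · simp

variable {n : ℕ} {S : Finset (PV n)} {orient : PV n → Bool}

lemma infl_adj (x y : InflV n S) : (inflPrism n S orient).Adj x y ↔
    (x.val.1 = y.val.1 ∧ x.val.1 ∈ S ∧ TF.Adj x.val.2 y.val.2) ∨
    (x.val.1 ≠ y.val.1 ∧ (prismG n).Adj x.val.1 y.val.1 ∧
      x.val.2 = port S orient x.val.1 y.val.1 ∧
      y.val.2 = port S orient y.val.1 x.val.1) := by
  simp only [inflPrism, SimpleGraph.fromRel_adj]
  constructor
  · rintro ⟨h, (h1 | h1) | (h1 | h1)⟩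
    · exact Or.inl h1
    · exact Or.inr h1
    · exact Or.inl ⟨h1.1.symm, h1.1 ▸ h1.2.1, h1.2.2.symm⟩
    · exact Or.inr ⟨h1.1.symm, h1.2.1.symm, h1.2.2.2, h1.2.2.1⟩
  · intro h
    refine ⟨?_, Or.inl h⟩
    rintro rfl
    rcases h with h | h
    · exact h.2.2.ne rfl
    · exact h.1 rfl

/-- fragment vertex -/
def fv (v : PV n) (hv : v ∈ S) (k : Fin 15) : InflV n S := ⟨(v, k), Or.inl hv⟩

lemma fv_inj (v : PV n) (hv : v ∈ S) (k m : Fin 15) : fv v hv k = fv v hv m ↔ k = m := by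
  constructor
  · intro h
    exact congrArg (fun x : InflV n S => x.val.2) h
  · rintro rfl; rfl

lemma fv_adj (v : PV n) (hv : v ∈ S) (k : Fin 15) (y : InflV n S)
    (h : (inflPrism n S orient).Adj (fv v hv k) y) :
    (∃ m, y = fv v hv m ∧ TF.Adj k m) ∨
    (∃ w, v ≠ w ∧ (prismG n).Adj v w ∧ k = port S orient v w ∧ y = liftV S orient w v) := by
  rw [infl_adj] at h
  obtain ⟨⟨w, m⟩, hy⟩ := y
  rcases h with ⟨h1, h2, h3⟩ | ⟨h1, h2, h3, h4⟩
  · left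
    simp only [fv] at h1 h2 h3
    subst h1
    exact ⟨m, rfl, h3⟩
  · right
    exact ⟨w, h1, h2, h3, Subtype.ext (Prod.ext rfl h4)⟩

lemma port_mem (v w : PV n) (hv : v ∈ S) : port S orient v w = 0 ∨ port S orient v w = 1 ∨
    port S orient v w = 2 := by
  unfold port; split_ifs <;> simp

open Classical in
noncomputable def chi {V : Type*} (U : V → V → Prop) (x y : V) : ℕ := if U x y then 1 else 0

lemma chi_le {V : Type*} (U : V → V → Prop) (x y : V) : chi U x y ≤ 1 := by
  unfold chi; split_ifs <;> simp

lemma chi_one {V : Type*} (U : V → V → Prop) (x y : V) : chi U x y = 1 ↔ U x y := by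
  by_cases h : U x y <;> simp [chi, h]

lemma HamU.comm {V : Type*} {G : SimpleGraph V} {U : V → V → Prop} (H : HamU G U) (x y : V) :
    chi U x y = chi U y x := by
  have : U x y ↔ U y x := ⟨H.symm _ _, H.symm _ _⟩
  by_cases h : U y x <;> simp [chi, h, this]

lemma HamU.deg' {V : Type*} {G : SimpleGraph V} {U : V → V → Prop} (H : HamU G U) (v a b c : V)
    (h1 : a ≠ b) (h2 : a ≠ c) (h3 : b ≠ c) (h : ∀ w, G.Adj v w → w = a ∨ w = b ∨ w = c) :
    chi U v a + chi U v b + chi U v c = 2 := by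
  rcases H.deg v a b c h1 h2 h3 h with h | h | h <;> simp [chi, h]

variable {U : InflV n S → InflV n S → Prop}

lemma deg_int (H : HamU (inflPrism n S orient) U) (v : PV n) (hv : v ∈ S) (k a b c : Fin 15)
    (hk : 2 < k) (hab : a ≠ b) (hac : a ≠ c) (hbc : b ≠ c)
    (h : ∀ m, TF.Adj k m → m = a ∨ m = b ∨ m = c) :
    chi U (fv v hv k) (fv v hv a) + chi U (fv v hv k) (fv v hv b)
      + chi U (fv v hv k) (fv v hv c) = 2 := by
  apply H.deg'
  · simpa [fv_inj]
  · simpa [fv_inj]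
  · simpa [fv_inj]
  · intro w hw
    rcases fv_adj v hv k w hw with ⟨m, rfl, hm⟩ | ⟨w', h1, h2, h3, h4⟩
    · simpa [fv_inj] using h m hm
    · exfalso
      rcases port_mem (orient := orient) v w' hv with h | h | h <;> rw [h] at h3 <;> subst h3 <;>
        revert hk <;> decide

lemma deg_port (H : HamU (inflPrism n S orient) U) (v : PV n) (hv : v ∈ S) (k a b : Fin 15)
    (u : PV n) (hu : u ≠ v) (hab : a ≠ b)
    (h : ∀ m, TF.Adj k m → m = a ∨ m = b)
    (hp : ∀ w, (prismG n).Adj v w → k = port S orient v w → w = u) :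
    chi U (fv v hv k) (fv v hv a) + chi U (fv v hv k) (fv v hv b)
      + chi U (fv v hv k) (liftV S orient u v) = 2 := by
  have aux : ∀ m, fv v hv m ≠ liftV S orient u v := by
    intro m h
    exact hu (congrArg (fun x : InflV n S => x.val.1) h).symm
  apply H.deg'
  · simpa [fv_inj]
  · exact aux _
  · exact aux _
  · intro w hw
    rcases fv_adj v hv k w hw with ⟨m, rfl, hm⟩ | ⟨w', h1, h2, h3, h4⟩
    · rcases h m hm with h | h <;> simp [h]
    · rw [hp w' h2 h3] at h4; simp [h4]

lemma frag_cut (H : HamU (inflPrism n S orient) U) (v : PV n) (hv : v ∈ S) (u2 : PV n)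
    (hp : ∀ w, (prismG n).Adj v w → 2 = port S orient v w → w = u2)
    (hc : chi U (fv v hv 2) (liftV S orient u2 v) = 0)
    (A : Finset (Fin 15)) (k0 : Fin 15) (hk0 : k0 ∈ A) (h0 : 0 ∉ A) (h1 : 1 ∉ A)
    (L : List (Fin 15 × Fin 15))
    (hL : ∀ k ∈ A, ∀ m, m ∉ A → TF.Adj k m → (k, m) ∈ L) :
    1 ≤ (L.map (fun p => chi U (fv v hv p.1) (fv v hv p.2))).sum := by
  obtain ⟨x, ⟨k, hk, rfl⟩, y, hy, hU⟩ := H.cut {x | ∃ k ∈ A, x = fv v hv k} (fv v hv k0)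
    ⟨k0, hk0, rfl⟩ (fv v hv 0) (by
      rintro ⟨k, hk, h⟩
      rw [fv_inj] at h
      exact h0 (h ▸ hk))
  rcases fv_adj v hv k y (H.adj _ _ hU) with ⟨m, rfl, hm⟩ | ⟨w, h1', h2, h3, h4⟩
  · have hmA : m ∉ A := fun h => hy ⟨m, h, rfl⟩
    have := hL k hk m hmA hm
    have h5 : chi U (fv v hv k) (fv v hv m) ∈
      L.map (fun p => chi U (fv v hv p.1) (fv v hv p.2)) := List.mem_map.2 ⟨_, this, rfl⟩
    rw [(chi_one U _ _).2 hU] at h5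
    exact List.le_sum_of_mem h5
  · exfalso
    rcases port_mem (orient := orient) v w hv with h | h | h <;> rw [h] at h3 <;> subst h3
    · exact h0 hk
    · exact h1 hk
    · rw [hp w h2 h.symm] at h4
      rw [h4] at hU
      rw [(chi_one U _ _).2 hU] at hc
      exact absurd hc (by norm_num)

lemma frag_main (H : HamU (inflPrism n S orient) U) (v : PV n) (hv : v ∈ S) (u0 u1 u2 : PV n)
    (hu0 : u0 ≠ v) (hu1 : u1 ≠ v) (hu2 : u2 ≠ v)
    (hp0 : ∀ w, (prismG n).Adj v w → 0 = port S orient v w → w = u0)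
    (hp1 : ∀ w, (prismG n).Adj v w → 1 = port S orient v w → w = u1)
    (hp2 : ∀ w, (prismG n).Adj v w → 2 = port S orient v w → w = u2) :
    chi U (fv v hv 0) (liftV S orient u0 v) + chi U (fv v hv 1) (liftV S orient u1 v) = 1 ∧
    chi U (fv v hv 2) (liftV S orient u2 v) = 1 := by
  have d0 := deg_port H v hv 0 4 14 u0 hu0 (by decide) (by decide) hp0
  have d1 := deg_port H v hv 1 7 14 u1 hu1 (by decide) (by decide) hp1
  have d2 := deg_port H v hv 2 6 8 u2 hu2 (by decide) (by decide) hp2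
  have d3 := deg_int H v hv 3 9 10 14 (by decide) (by decide) (by decide) (by decide) (by decide)
  have d4 := deg_int H v hv 4 0 5 9 (by decide) (by decide) (by decide) (by decide) (by decide)
  have d5 := deg_int H v hv 5 4 6 11 (by decide) (by decide) (by decide) (by decide) (by decide)
  have d6 := deg_int H v hv 6 5 2 13 (by decide) (by decide) (by decide) (by decide) (by decide)
  have d7 := deg_int H v hv 7 1 8 10 (by decide) (by decide) (by decide) (by decide) (by decide)
  have d8 := deg_int H v hv 8 7 2 13 (by decide) (by decide) (by decide) (by decide) (by decide)
  have d9 := deg_int H v hv 9 4 3 11 (by decide) (by decide) (by decide) (by decide) (by decide)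
  have d10 := deg_int H v hv 10 3 7 12 (by decide) (by decide) (by decide) (by decide) (by decide)
  have d11 := deg_int H v hv 11 5 12 9 (by decide) (by decide) (by decide) (by decide) (by decide)
  have d12 := deg_int H v hv 12 11 13 10 (by decide) (by decide) (by decide) (by decide) (by decide)
  have d13 := deg_int H v hv 13 6 8 12 (by decide) (by decide) (by decide) (by decide) (by decide)
  have d14 := deg_int H v hv 14 0 1 3 (by decide) (by decide) (by decide) (by decide) (by decide)
  have par := tf_parity (fun i j => chi U (fv v hv i) (fv v hv j)) (fun i j => H.comm _ _) _ _ _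
    d0 d1 d2 d3 d4 d5 d6 d7 d8 d9 d10 d11 d12 d13 d14
  have l0 := chi_le U (fv v hv 0) (liftV S orient u0 v)
  have l1 := chi_le U (fv v hv 1) (liftV S orient u1 v)
  have l2 := chi_le U (fv v hv 2) (liftV S orient u2 v)
  -- nonzero
  have nz : 1 ≤ chi U (fv v hv 0) (liftV S orient u0 v) + chi U (fv v hv 1) (liftV S orient u1 v)
      + chi U (fv v hv 2) (liftV S orient u2 v) := by
    obtain ⟨x, ⟨k, rfl⟩, y, hy, hU⟩ := H.cut {x | ∃ k, x = fv v hv k} (fv v hv 0)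
      ⟨0, rfl⟩ (liftV S orient u0 v) (by
        rintro ⟨k, h⟩
        exact hu0 (congrArg (fun x : InflV n S => x.val.1) h))
    rcases fv_adj v hv k y (H.adj _ _ hU) with ⟨m, rfl, hm⟩ | ⟨w, h1', h2, h3, h4⟩
    · exact absurd ⟨m, rfl⟩ hy
    · have e := (chi_one U _ _).2 hU
      rcases port_mem (orient := orient) v w hv with h | h | h <;> rw [h] at h3 <;> subst h3 
      · rw [h4, hp0 w h2 h.symm] at e; omega
      · rw [h4, hp1 w h2 h.symm] at e; omega
      · rw [h4, hp2 w h2 h.symm] at e; omega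
  by_cases hc : chi U (fv v hv 2) (liftV S orient u2 v) = 0
  · exfalso
    have ha : chi U (fv v hv 0) (liftV S orient u0 v) = 1 := by omega
    have hb : chi U (fv v hv 1) (liftV S orient u1 v) = 1 := by omega
    have c1 := frag_cut H v hv u2 hp2 hc {2,3,4,5,6,7,8,9,10,11,12,13} 2 (by decide) (by decide)
      (by decide) [(4,0),(7,1),(3,14)] (by decide)
    have c2 := frag_cut H v hv u2 hp2 hc {2,6,8,13} 2 (by decide) (by decide)
      (by decide) [(6,5),(8,7),(13,12)] (by decide)
    have c3 := frag_cut H v hv u2 hp2 hc {4,5,9,11} 4 (by decide) (by decide)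
      (by decide) [(4,0),(5,6),(9,3),(11,12)] (by decide)
    have c4 := frag_cut H v hv u2 hp2 hc {2,4,5,6,8,9,11,12,13} 4 (by decide) (by decide)
      (by decide) [(4,0),(9,3),(8,7),(12,10)] (by decide)
    have c5 := frag_cut H v hv u2 hp2 hc {2,6,7,8,10,12,13} 2 (by decide) (by decide)
      (by decide) [(6,5),(7,1),(12,11),(10,3)] (by decide)
    simp only [List.map_cons, List.map_nil, List.sum_cons, List.sum_nil, add_zero, ← add_assoc]
      at c1 c2 c3 c4 c5
    rw [ha] at d0
    rw [hb] at d1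
    rw [hc] at d2
    exact tf_noab (fun i j => chi U (fv v hv i) (fv v hv j)) (fun i j => H.comm _ _)
      (fun i j => chi_le _ _ _)
      d0 d1 d2 d3 d4 d5 d6 d7 d8 d9 d10 d11 d12 d13 d14 c1 c2 c3 c4 c5
  · omega

noncomputable def ee (orient : PV n → Bool) (U : InflV n S → InflV n S → Prop) (v w : PV n) : ℕ :=
  chi U (liftV S orient v w) (liftV S orient w v)

lemma ee_comm (H : HamU (inflPrism n S orient) U) (v w : PV n) :
    ee orient U v w = ee orient U w v := H.comm _ _

lemma liftV_eq (v w : PV n) (hv : v ∈ S) (k : Fin 15) (h : port S orient v w = k) :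
    liftV S orient v w = fv v hv k := by
  subst h; rfl

lemma vertex_main (hn : 3 ≤ n) (H : HamU (inflPrism n S orient) U) (i : ZMod n) (s : Bool) :
    ee orient U (i, s) (i + 1, s) + ee orient U (i, s) (i - 1, s) + ee orient U (i, s) (i, !s) = 2
    ∧ ((i, s) ∈ S → ee orient U (i, s) (i, !s) = 1) := by
  have h1 := zmod_ne1 hn i
  have h2 := zmod_ne2 hn i
  have h3 := zmod_ne3 hn i
  have adj := prism_adj hn i s
  by_cases hv : (i, s) ∈ S
  · have pr : port S orient (i, s) (i + 1, s) = if orient (i, s) then 0 else 1 := by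
      simp [port, hv, h1, Ne.symm h1]
    have pl : port S orient (i, s) (i - 1, s) = if orient (i, s) then 1 else 0 := by
      simp [port, hv, h2, Ne.symm h3]
    have pp : port S orient (i, s) (i, !s) = 2 := by
      simp [port, hv]
    by_cases ho : orient (i, s)
    · simp only [ho, if_true] at pr pl
      have := frag_main H (i, s) hv (i + 1, s) (i - 1, s) (i, !s) (by simp [h1]) (by simp [h3])
        (by simp)
        (by intro w hw hp; rcases (adj w).1 hw with rfl | rfl | rfl <;> simp_all)
        (by intro w hw hp; rcases (adj w).1 hw with rfl | rfl | rfl <;> simp_all)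
        (by intro w hw hp; rcases (adj w).1 hw with rfl | rfl | rfl <;> simp_all)
      simp only [ee, liftV_eq _ _ hv _ pr, liftV_eq _ _ hv _ pl, liftV_eq _ _ hv _ pp]
      exact ⟨by omega, fun _ => by omega⟩
    · simp only [ho] at pr pl
      have := frag_main H (i, s) hv (i - 1, s) (i + 1, s) (i, !s) (by simp [h3]) (by simp [h1])
        (by simp)
        (by intro w hw hp; rcases (adj w).1 hw with rfl | rfl | rfl <;> simp_all)
        (by intro w hw hp; rcases (adj w).1 hw with rfl | rfl | rfl <;> simp_all)
        (by intro w hw hp; rcases (adj w).1 hw with rfl | rfl | rfl <;> simp_all)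
      simp only [ee, liftV_eq _ _ hv _ pr, liftV_eq _ _ hv _ pl, liftV_eq _ _ hv _ pp]
      exact ⟨by simp at this ⊢; omega, fun _ => by omega⟩
  · refine ⟨?_, fun h => absurd h hv⟩
    have e : ∀ w, liftV S orient (i, s) w = ⟨((i, s), 0), Or.inr rfl⟩ := by
      intro w
      apply Subtype.ext
      simp [liftV, port, hv]
    simp only [ee, e]
    have ne : ∀ a b v : PV n, a ≠ b → liftV S orient a v ≠ liftV S orient b v := by
      intro a b v hab h
      exact hab (congrArg (fun x : InflV n S => x.val.1) h)
    apply H.deg'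
    · exact ne _ _ _ (by simp [Ne.symm h2])
    · exact ne _ _ _ (by simp)
    · exact ne _ _ _ (by simp)
    · intro w hw
      have hw := (infl_adj _ _).1 hw
      obtain ⟨⟨w, m⟩, hy⟩ := w
      rcases hw with ⟨_, h, _⟩ | ⟨g1, g2, g3, g4⟩
      · exact absurd h hv
      · simp only at g1 g2 g3 g4
        subst g4
        rcases (adj w).1 g2 with rfl | rfl | rfl
        · left; rfl
        · right; left; rfl
        · right; right; rfl

lemma prism_cut (hn : 3 ≤ n) (H : HamU (inflPrism n S orient) U) (A : Set (PV n)) (x y : PV n)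
    (hx : x ∈ A) (hy : y ∉ A) :
    ∃ u ∈ A, ∃ w, w ∉ A ∧ (prismG n).Adj u w ∧ ee orient U u w = 1 := by
  obtain ⟨a, ha, b, hb, hU⟩ := H.cut {z | z.val.1 ∈ A} (liftV S orient x y) hx
    (liftV S orient y x) hy
  have hadj := H.adj _ _ hU
  rw [infl_adj] at hadj
  obtain ⟨⟨u, k⟩, h1⟩ := a
  obtain ⟨⟨w, m⟩, h2⟩ := b
  rcases hadj with ⟨h, _⟩ | ⟨g1, g2, g3, g4⟩
  · exfalso
    apply hb
    have ha' : u ∈ A := ha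
    have h' : u = w := h
    rw [h'] at ha'
    exact ha'
  · simp only at g1 g2 g3 g4
    subst g3 g4
    exact ⟨u, ha, w, hb, g2, (chi_one U _ _).2 hU⟩

lemma no_two_gaps (hn : 3 ≤ n) (H : HamU (inflPrism n S orient) U) (g h : ZMod n) (hgh : g ≠ h)
    (hg : ∀ s, ee orient U (g, s) (g + 1, s) = 0) (hh : ∀ s, ee orient U (h, s) (h + 1, s) = 0) :
    False := by
  have : NeZero n := ⟨by omega⟩
  have hf : Fact (1 < n) := ⟨by omega⟩
  have hm1 : ((-1 : ZMod n)).val = n - 1 := by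
    rw [ZMod.neg_val, if_neg one_ne_zero, ZMod.val_one]
  have hlt : (h - (g + 1)).val < n - 1 := by
    have h1 := ZMod.val_lt (h - (g + 1))
    rcases Nat.lt_or_ge (h - (g + 1)).val (n - 1) with h2 | h2
    · exact h2
    · exfalso
      have h3 : (h - (g + 1)).val = (-1 : ZMod n).val := by omega
      have := ZMod.val_injective n h3
      apply hgh
      linear_combination -this
  have step : ∀ z : ZMod n, z.val < n - 1 → (z + 1).val = z.val + 1 := by
    intro z hz
    rw [ZMod.val_add_of_lt] <;> rw [ZMod.val_one]
    omega
  obtain ⟨⟨i, s⟩, hu, w, hw, ha, he⟩ := prism_cut hn H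
    {v | (v.1 - (g + 1)).val ≤ (h - (g + 1)).val} (h, false) (g, false) (by simp) (by
      have : g - (g + 1) = -1 := by ring
      simp only [Set.mem_ofPred_eq, this, hm1]
      omega)
  simp only [Set.mem_ofPred_eq] at hu hw
  rcases (prism_adj hn i s w).1 ha with rfl | rfl | rfl
  · have e : i + 1 - (g + 1) = (i - (g + 1)) + 1 := by ring
    simp only [e, step _ (lt_of_le_of_lt hu hlt)] at hw
    have h3 : (i - (g + 1)).val = (h - (g + 1)).val := by omega
    have h4 := ZMod.val_injective n h3
    have h5 : i = h := by linear_combination h4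
    subst h5
    rw [hh] at he; omega
  · simp only at hw
    have e : i - (g + 1) = (i - 1 - (g + 1)) + 1 := by ring
    rcases Nat.lt_or_ge (i - 1 - (g + 1)).val (n - 1) with h2 | h2
    · rw [e, step _ h2] at hu
      omega
    · have h1 := ZMod.val_lt (i - 1 - (g + 1))
      have h3 : (i - 1 - (g + 1)).val = (-1 : ZMod n).val := by omega
      have h4 := ZMod.val_injective n h3
      have h5 : i = g + 1 := by linear_combination h4
      subst h5
      rw [ee_comm H] at he
      have e6 : g + 1 - 1 = g := by ring
      rw [e6, hg] at he; omega
  · exact hw hu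

lemma ham_even (hn : 3 ≤ n) (H : HamU (inflPrism n S orient) U)
    (hpil : 3 ≤ (inflatedPillars S).ncard) : Even n := by
  have : NeZero n := ⟨by omega⟩
  set b : ZMod n → ℕ := fun i => ee orient U (i, false) (i + 1, false) with hb
  set t : ZMod n → ℕ := fun i => ee orient U (i, true) (i + 1, true) with ht
  set p : ZMod n → ℕ := fun i => ee orient U (i, false) (i, true) with hp
  have hb1 : ∀ i, b i ≤ 1 := fun i => chi_le _ _ _
  have ht1 : ∀ i, t i ≤ 1 := fun i => chi_le _ _ _
  have hp1 : ∀ i, p i ≤ 1 := fun i => chi_le _ _ _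
  have eb : ∀ i, b (i + 1) + b i + p (i + 1) = 2 := by
    intro i
    have := (vertex_main hn H (i + 1) false).1
    rw [ee_comm H _ (i + 1 - 1, false), add_sub_cancel_right] at this
    exact this
  have et : ∀ i, t (i + 1) + t i + p (i + 1) = 2 := by
    intro i
    have := (vertex_main hn H (i + 1) true).1
    rw [ee_comm H _ (i + 1 - 1, true), add_sub_cancel_right, ee_comm H _ (i + 1, !true)] at this
    exact this
  have hS : ∀ i ∈ inflatedPillars S, p i = 1 := by
    rintro i (h | h)
    · exact (vertex_main hn H i false).2 h
    · have := (vertex_main hn H i true).2 h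
      rw [ee_comm H] at this
      exact this
  by_cases hall : ∀ i, p i = 1
  · have : ∀ k : ℕ, b (k : ZMod n) = if Even k then b 0 else 1 - b 0 := by
      intro k
      induction k with
      | zero => simp
      | succ k ih =>
        have h1 := eb (k : ZMod n)
        have h2 := hall ((k : ZMod n) + 1)
        have h3 := hb1 0
        push_cast
        by_cases hk : Even k
        · simp only [hk, if_true] at ih
          simp only [Nat.even_add_one, hk, not_true, if_false]
          omega
        · simp only [hk, if_false] at ih
          simp only [Nat.even_add_one, hk, not_false_iff, if_true]
          omega
    have h := this n
    by_contra hne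
    rw [if_neg hne, ZMod.natCast_self] at h
    omega
  · exfalso
    push Not at hall
    obtain ⟨k, hk⟩ := hall
    have hbt : ∀ m : ℕ, b (k + m) = t (k + m) := by
      intro m
      induction m with
      | zero =>
        have h1 := eb (k - 1)
        have h2 := et (k - 1)
        rw [sub_add_cancel] at h1 h2
        have := hp1 k
        have := hb1 k
        have := hb1 (k - 1)
        have := ht1 k
        have := ht1 (k - 1)
        simp only [Nat.cast_zero, add_zero]
        omega
      | succ m ih =>
        have h1 := eb (k + m)
        have h2 := et (k + m)
        push_cast
        rw [← add_assoc]
        omega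
    have hbt' : ∀ i, b i = t i := by
      intro i
      have := hbt (i - k).val
      rwa [ZMod.natCast_zmod_val, add_sub_cancel] at this
    have gap : ∀ i ∈ inflatedPillars S, ∃ g, b g = 0 ∧ (i = g ∨ i = g + 1) := by
      intro i hi
      have h1 := hS i hi
      have h2 := eb (i - 1)
      rw [sub_add_cancel] at h2
      have := hb1 i
      rcases (by omega : b i = 0 ∨ b (i - 1) = 0) with h | h
      · exact ⟨i, h, Or.inl rfl⟩
      · exact ⟨i - 1, h, Or.inr (by ring)⟩
    have uniq : ∀ g h, b g = 0 → b h = 0 → g = h := by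
      intro g h hg hh
      by_contra hne
      refine no_two_gaps hn H g h hne ?_ ?_
      · rintro (_ | _)
        · exact hg
        · exact (hbt' g).symm.trans hg
      · rintro (_ | _)
        · exact hh
        · exact (hbt' h).symm.trans hh
    obtain ⟨x, hx, y, hy, z, hz, hxy, hxz, hyz⟩ :=
      (Set.two_lt_ncard (Set.toFinite _)).1 (show 2 < (inflatedPillars S).ncard by omega)
    obtain ⟨g1, h1, h1'⟩ := gap x hx
    obtain ⟨g2, h2, h2'⟩ := gap y hy
    obtain ⟨g3, h3, h3'⟩ := gap z hz
    have := uniq _ _ h1 h2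
    have := uniq _ _ h1 h3
    subst g2 g3
    grind

lemma cyc_of_list {V : Type*} [DecidableEq V] {G : SimpleGraph V} (l : List V) (h3 : 3 ≤ l.length)
    (hnd : l.Nodup) (hch : l.IsChain G.Adj) (hmem : ∀ x, x ∈ l)
    (hcl : ∀ x ∈ l.getLast?, ∀ y ∈ l.head?, G.Adj x y) :
    ∃ (x : V) (C : G.Walk x x), C.IsHamiltonianCycle := by
  have hne : l ≠ [] := by rintro rfl; simp at h3
  have hadj : G.Adj (l.getLast hne) (l.head hne) :=
    hcl _ (List.getLast_mem_getLast? hne) _ (List.head_mem_head? hne)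
  let w := SimpleGraph.Walk.ofSupport l hne hch
  have hw : w.support = l := SimpleGraph.Walk.support_ofSupport hne hch
  have hwp : w.IsPath := by rw [SimpleGraph.Walk.isPath_def, hw]; exact hnd
  have hwl : w.length = l.length - 1 := SimpleGraph.Walk.length_ofSupport hne hch
  refine ⟨_, SimpleGraph.Walk.cons hadj w, ?_, ?_⟩
  · rw [SimpleGraph.Walk.isCycle_iff_isPath_tail_and_le_length]
    refine ⟨by simpa using hwp, ?_⟩
    rw [SimpleGraph.Walk.length_cons]
    omega
  · have : w.IsHamiltonian := hwp.isHamiltonian_of_mem (by rw [hw]; exact hmem)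
    intro a
    simpa using this a

def pathA : List (Fin 15) := [0,4,9,3,14,1,7,10,12,11,5,6,13,8,2]
def pathB : List (Fin 15) := [1,14,0,4,9,3,10,7,8,13,12,11,5,6,2]

def tpath (k : Fin 15) : List (Fin 15) := if k = 0 then pathA else pathB

def seg (S : Finset (PV n)) (orient : PV n → Bool) (v w : PV n) : List (InflV n S) :=
  if hv : v ∈ S then (tpath (port S orient v w)).map (fv v hv)
  else [liftV S orient v w]

lemma seg_ne (v w : PV n) : seg S orient v w ≠ [] := by
  unfold seg tpath; split_ifs <;> simp [pathA, pathB]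

lemma seg_mem (v w : PV n) (x : InflV n S) : x ∈ seg S orient v w ↔ x.val.1 = v := by
  unfold seg
  split_ifs with hv
  · rw [List.mem_map]
    constructor
    · rintro ⟨m, _, h⟩
      exact (congrArg (fun x : InflV n S => x.val.1) h).symm
    · intro h
      refine ⟨x.val.2, ?_, Subtype.ext (Prod.ext h.symm rfl)⟩
      generalize x.val.2 = k
      unfold tpath
      split_ifs <;> revert k <;> decide
  · rw [List.mem_singleton]
    constructor
    · intro h
      exact (congrArg (fun x : InflV n S => x.val.1) h)
    · intro h
      have h0 : port S orient v w = 0 := by simp [port, hv]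
      rcases x.property with hx | hx
      · exact absurd (h ▸ hx) hv
      · exact Subtype.ext (Prod.ext h (hx.trans h0.symm))

lemma seg_nodup (v w : PV n) : (seg S orient v w).Nodup := by
  unfold seg
  split_ifs with hv
  · refine List.Nodup.map (fun a b h => (fv_inj v hv a b).1 h) ?_
    unfold tpath
    split_ifs <;> decide
  · simp

lemma seg_chain (v w : PV n) : (seg S orient v w).IsChain (inflPrism n S orient).Adj := by
  unfold seg
  split_ifs with hv
  · rw [List.isChain_map]
    have : (tpath (port S orient v w)).IsChain TF.Adj := by
      unfold tpath
      split_ifs <;> simp only [pathA, pathB, List.isChain_cons_cons, List.isChain_singleton] <;>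
        decide
    refine this.imp ?_
    intro a b hab
    rw [infl_adj]
    exact Or.inl ⟨rfl, hv, hab⟩
  · simp

lemma seg_head (v w : PV n) (h : v ∈ S → port S orient v w = 0 ∨ port S orient v w = 1) :
    (seg S orient v w).head? = some (liftV S orient v w) := by
  unfold seg
  split_ifs with hv
  · rcases h hv with h | h
    · rw [liftV_eq v w hv _ h, h]; rfl
    · rw [liftV_eq v w hv _ h, h]; rfl
  · rfl

lemma seg_last (v w u : PV n) (h : v ∈ S → port S orient v u = 2) :
    (seg S orient v w).getLast? = some (liftV S orient v u) := by
  unfold seg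
  split_ifs with hv
  · rw [liftV_eq v u hv _ (h hv)]
    unfold tpath
    split_ifs <;> rfl
  · have h0 : ∀ u, port S orient v u = 0 := by intro u; simp [port, hv]
    have : liftV S orient v w = liftV S orient v u :=
      Subtype.ext (Prod.ext rfl ((h0 w).trans (h0 u).symm))
    rw [this]; rfl

lemma lift_adj (v w : PV n) (h : (prismG n).Adj v w) :
    (inflPrism n S orient).Adj (liftV S orient v w) (liftV S orient w v) := by
  rw [infl_adj]
  exact Or.inr ⟨h.ne, h, rfl, rfl⟩

def blk (S : Finset (PV n)) (orient : PV n → Bool) (i : ZMod n) (s : Bool) : List (InflV n S) :=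
  seg S orient (i, s) (i - 1, s) ++ (seg S orient (i, !s) (i + 1, !s)).reverse

lemma blk_ne (i : ZMod n) (s : Bool) : blk S orient i s ≠ [] := by
  simp [blk, seg_ne]

lemma blk_mem (i : ZMod n) (s : Bool) (x : InflV n S) : x ∈ blk S orient i s ↔ x.val.1.1 = i := by
  simp only [blk, List.mem_append, List.mem_reverse, seg_mem, Prod.ext_iff]
  cases s <;> cases x.val.1.2 <;> simp

lemma blk_nodup (i : ZMod n) (s : Bool) : (blk S orient i s).Nodup := by
  unfold blk
  rw [List.nodup_append']
  refine ⟨seg_nodup _ _, List.nodup_reverse.2 (seg_nodup _ _), ?_⟩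
  intro x h1 h2
  rw [List.mem_reverse, seg_mem] at h2
  rw [seg_mem, h2] at h1
  simp at h1

lemma blk_head (hn : 3 ≤ n) (i : ZMod n) (s : Bool) :
    (blk S orient i s).head? = some (liftV S orient (i, s) (i - 1, s)) := by
  unfold blk
  rw [List.head?_append_of_ne_nil _ (seg_ne _ _), seg_head]
  intro hv
  have h2 := zmod_ne2 hn i
  have h3 := zmod_ne3 hn i
  simp only [port, hv, h2, Ne.symm h3]
  cases orient (i, s) <;> simp

lemma blk_last (hn : 3 ≤ n) (i : ZMod n) (s : Bool) :
    (blk S orient i s).getLast? = some (liftV S orient (i, !s) (i + 1, !s)) := by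
  unfold blk
  rw [List.getLast?_append_of_ne_nil _ (by simp [seg_ne]), List.getLast?_reverse, seg_head]
  intro hv
  have h1 := zmod_ne1 hn i
  simp only [port, hv, Ne.symm h1]
  cases orient (i, !s) <;> simp

lemma blk_chain (hn : 3 ≤ n) (i : ZMod n) (s : Bool) :
    (blk S orient i s).IsChain (inflPrism n S orient).Adj := by
  unfold blk
  rw [List.isChain_append, List.isChain_reverse]
  refine ⟨seg_chain _ _, (seg_chain _ _).imp fun a b h => h.symm, ?_⟩
  rw [seg_last _ _ (i, !s) (by intro hv; simp [port, hv]), List.head?_reverse,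
    seg_last _ _ (i, s) (by intro hv; simp [port, hv])]
  intro x hx y hy
  simp only [Option.mem_def, Option.some.injEq] at hx hy
  subst hx hy
  exact lift_adj _ _ ((prism_adj hn _ _ _).2 (by simp))

lemma even_ham (hn : 3 ≤ n) (he : Even n) :
    ∃ (x : InflV n S) (C : (inflPrism n S orient).Walk x x), C.IsHamiltonianCycle := by
  have : NeZero n := ⟨by omega⟩
  let f : ℕ → List (InflV n S) := fun k => blk S orient (k : ZMod n) (decide (k % 2 = 1))
  have fadj : ∀ k : ℕ, ∀ j : ZMod n, ∀ s : Bool, j = (k : ZMod n) + 1 →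
      s = (!decide (k % 2 = 1)) → ∀ x ∈ (f k).getLast?, ∀ y ∈ (blk S orient j s).head?,
      (inflPrism n S orient).Adj x y := by
    rintro k j s rfl rfl x hx y hy
    rw [blk_last hn] at hx
    rw [blk_head hn] at hy
    simp only [Option.mem_def, Option.some.injEq] at hx hy
    subst hx hy
    rw [add_sub_cancel_right]
    exact lift_adj _ _ ((prism_adj hn _ _ _).2 (by simp))
  have hmem : ∀ x : InflV n S, x ∈ ((List.range n).map f).flatten := by
    intro x
    rw [List.mem_flatten]
    refine ⟨f x.val.1.1.val, List.mem_map.2 ⟨_, List.mem_range.2 (ZMod.val_lt _), rfl⟩, ?_⟩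
    rw [blk_mem, ZMod.natCast_zmod_val]
  have hnil : [] ∉ (List.range n).map f := by
    intro h
    obtain ⟨k, _, hk⟩ := List.mem_map.1 h
    exact blk_ne _ _ hk
  apply cyc_of_list ((List.range n).map f).flatten
  · let g : InflV n S → ZMod n := fun x => x.val.1.1
    have h1 : (Finset.univ : Finset (ZMod n)) ⊆
        (((List.range n).map f).flatten.map g).toFinset := by
      intro i _
      rw [List.mem_toFinset, List.mem_map]
      exact ⟨liftV S orient (i, false) (i, false), hmem _, rfl⟩
    have h2 := (Finset.card_le_card h1).trans (List.toFinset_card_le _)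
    rw [Finset.card_univ, ZMod.card, List.length_map] at h2
    omega
  · rw [List.nodup_flatten]
    refine ⟨?_, ?_⟩
    · intro l hl
      obtain ⟨k, _, rfl⟩ := List.mem_map.1 hl
      exact blk_nodup _ _
    · rw [List.pairwise_map]
      refine (List.nodup_range (n := n)).imp_of_mem ?_
      intro a b ha hb hab x hxa hxb
      rw [blk_mem] at hxa hxb
      rw [hxa, ZMod.natCast_eq_natCast_iff', Nat.mod_eq_of_lt (List.mem_range.1 ha),
        Nat.mod_eq_of_lt (List.mem_range.1 hb)] at hxb
      exact hab hxb
  · rw [List.isChain_flatten hnil]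
    refine ⟨?_, ?_⟩
    · intro l hl
      obtain ⟨k, _, rfl⟩ := List.mem_map.1 hl
      exact blk_chain hn _ _
    · rw [List.isChain_map, List.isChain_range]
      intro m _
      exact fadj m _ _ (by push_cast; rfl) (by
        rcases Nat.mod_two_eq_zero_or_one m with h | h <;> simp [Nat.succ_eq_add_one, Nat.add_mod, h])
  · exact hmem
  · obtain ⟨m, rfl⟩ : ∃ m, n = m + 1 := ⟨n - 1, by omega⟩
    intro x hx y hy
    have hx' : x ∈ (f m).getLast? := by
      rw [List.range_succ, List.map_append, List.flatten_append] at hx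
      rw [List.getLast?_append_of_ne_nil _ (by simpa using blk_ne _ _)] at hx
      simpa using hx
    have hy' : y ∈ (f 0).head? := by
      rw [List.range_succ_eq_map, List.map_cons, List.flatten_cons,
        List.head?_append_of_ne_nil _ (blk_ne _ _)] at hy
      exact hy
    refine fadj m _ _ ?_ ?_ x hx' y hy'
    · have := ZMod.natCast_self (m + 1)
      push_cast at this
      simp [this]
    · rw [Nat.even_add_one, Nat.not_even_iff] at he
      simp [he]

end helpers

/-- Let `G` be obtained from `C_n □ K_2` by TF-inflations at vertices lying
on at least `r ≥ 3` distinct pillars.  Then `G` is hamiltonian iff `n` is even. -/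
theorem stmt9 (n : ℕ) (hn : 3 ≤ n) (S : Finset (PV n)) (orient : PV n → Bool)
    (r : ℕ) (hr : 3 ≤ r) (hpil : r ≤ (inflatedPillars S).ncard) :
    (∃ (x : InflV n S) (C : (inflPrism n S orient).Walk x x), C.IsHamiltonianCycle) ↔
      Even n := by
  constructor
  · rintro ⟨x, C, hC⟩
    exact ham_even hn (hamU_of_cycle C hC) (hr.trans hpil)
  · exact fun h => even_ham hn h
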